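/- Let n be a positive integer with prime factorization n = ∏_p p^{a_p}. Then the divisor sum of φ₂ satisfies ∑_{d | n} φ₂(d) = 2^{a_2} · ∏_{p | n, p odd prime} (p^{a_p}(p − 2) + 1)/(p − 1), where a_2 is the exponent of 2 in n (a_2 = 0 if n is odd); equivalently, ∑_{d | n} φ₂(d) = n · ∏_{p | n, p odd prime} (φ₂(p) + p^{−a_p})/φ(p). -/

import Mathlib

/-- The modified totient function `φ₂`. -/
def phi2 (n : ℕ) : ℕ :=
  ((Finset.Icc 1 n).filter (fun a => Nat.gcd a n = 1 ∧ Nat.gcd (a + 2) n = 1)).card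

theorem phi2_eq_card_range (n : ℕ) :
    phi2 n = ((Finset.range n).filter
      (fun a => Nat.gcd a n = 1 ∧ Nat.gcd (a + 2) n = 1)).card := by
  have hper : Function.Periodic (fun a => Nat.gcd a n = 1 ∧ Nat.gcd (a + 2) n = 1) n := by
    intro a
    simp [add_right_comm a n 2]
  have h := Nat.filter_Ico_card_eq_of_periodic 1 n _ hper
  rw [Nat.count_eq_card_filter_range] at h
  rw [← h, phi2]
  congr 2
  ext a
  simp only [Finset.mem_Icc, Finset.mem_Ico]
  omega

theorem phi2_eq_card_zmod (n : ℕ) [NeZero n] :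
    phi2 n = Nat.card {x : ZMod n // IsUnit x ∧ IsUnit (x + 2)} := by
  classical
  rw [phi2_eq_card_range, Nat.card_eq_fintype_card, Fintype.card_subtype]
  have hunit (a : ℕ) : (IsUnit (a : ZMod n) ∧ IsUnit ((a : ZMod n) + 2)) ↔
      Nat.gcd a n = 1 ∧ Nat.gcd (a + 2) n = 1 := by
    have h := ZMod.isUnit_iff_coprime (a + 2) n
    push_cast at h
    rw [ZMod.isUnit_iff_coprime, h]
  refine Finset.card_bij (fun a _ => (a : ZMod n)) ?_ ?_ ?_
  · intro a ha
    simpa [hunit] using (Finset.mem_filter.1 ha).2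
  · intro a ha b hb hab
    simp only [Finset.mem_filter, Finset.mem_range] at ha hb
    exact Nat.ModEq.eq_of_lt_of_lt ((ZMod.natCast_eq_natCast_iff _ _ _).1 hab) ha.1 hb.1
  · intro x hx
    refine ⟨x.val, ?_, ZMod.natCast_zmod_val x⟩
    simp only [Finset.mem_filter, Finset.mem_range, ZMod.val_lt, true_and, ← hunit,
      ZMod.natCast_zmod_val]
    simpa using hx

theorem phi2_mul {m n : ℕ} (h : Nat.Coprime m n) : phi2 (m * n) = phi2 m * phi2 n := by
  rcases Nat.eq_zero_or_pos m with rfl | hm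
  · simp [phi2]
  rcases Nat.eq_zero_or_pos n with rfl | hn
  · simp [phi2]
  have : NeZero m := ⟨hm.ne'⟩
  have : NeZero n := ⟨hn.ne'⟩
  rw [phi2_eq_card_zmod, phi2_eq_card_zmod, phi2_eq_card_zmod, ← Nat.card_prod]
  let e := ZMod.chineseRemainder h
  refine Nat.card_congr ((e.toEquiv.subtypeEquiv (q := fun y =>
    (IsUnit y.1 ∧ IsUnit (y.1 + 2)) ∧ (IsUnit y.2 ∧ IsUnit (y.2 + 2))) ?_).trans
    (Equiv.subtypeProdEquivProd (p := fun y : ZMod m => IsUnit y ∧ IsUnit (y + 2))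
      (q := fun y : ZMod n => IsUnit y ∧ IsUnit (y + 2))))
  intro x
  have h2 : e (x + 2) = e x + 2 := by rw [map_add, map_ofNat]
  rw [← MulEquiv.isUnit_map e, ← MulEquiv.isUnit_map e, h2, Prod.isUnit_iff, Prod.isUnit_iff]
  simp only [Prod.fst_add, Prod.snd_add, Prod.fst_ofNat, Prod.snd_ofNat]
  exact and_and_and_comm

theorem phi2_one : phi2 1 = 1 := by decide

theorem phi2_two : phi2 2 = 1 := by decide

theorem phi2_odd_prime {p : ℕ} (hp : p.Prime) (h2 : p ≠ 2) : phi2 p = p - 2 := by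
  have h3 : 3 ≤ p := by have := hp.two_le; omega
  have hset : (Finset.Icc 1 p).filter (fun a => Nat.gcd a p = 1 ∧ Nat.gcd (a + 2) p = 1) =
      ((Finset.Icc 1 p).erase p).erase (p - 2) := by
    ext a
    have hc (b : ℕ) : Nat.gcd b p = 1 ↔ ¬ p ∣ b := by
      rw [Nat.gcd_comm]; exact hp.coprime_iff_not_dvd
    simp only [Finset.mem_filter, Finset.mem_Icc, Finset.mem_erase, hc]
    constructor
    · rintro ⟨ha, h, h'⟩
      refine ⟨?_, ?_, ha⟩
      · rintro rfl
        exact h' (by rw [Nat.sub_add_cancel hp.two_le])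
      · rintro rfl
        exact h dvd_rfl
    · rintro ⟨h, h', ha⟩
      refine ⟨ha, fun hd => ?_, ?_⟩
      · have := Nat.le_of_dvd (by omega) hd
        omega
      · rintro ⟨k, hk⟩
        have : k < 2 := by
          by_contra! hk2
          have := Nat.mul_le_mul_left p hk2
          omega
        interval_cases k <;> omega
  rw [phi2, hset, Finset.card_erase_of_mem, Finset.card_erase_of_mem, Nat.card_Icc]
  · omega
  · simp; omega
  · simp only [Finset.mem_erase, Finset.mem_Icc]; omega

theorem count_mul_of_periodic (P : ℕ → Prop) [DecidablePred P] {p : ℕ}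
    (hP : Function.Periodic P p) (m : ℕ) : Nat.count P (p * m) = m * Nat.count P p := by
  induction m with
  | zero => simp
  | succ m ih =>
    have hshift (k : ℕ) : P (p * m + k) ↔ P k := by
      rw [add_comm, mul_comm]
      exact iff_of_eq (hP.nat_mul m k)
    rw [Nat.mul_succ, Nat.count_add, ih, Nat.succ_mul]
    simp only [hshift]

theorem phi2_pow_succ (p k : ℕ) :
    phi2 (p ^ (k + 1)) = p ^ k * phi2 p := by
  have hc (a : ℕ) : Nat.gcd a (p ^ (k + 1)) = 1 ↔ Nat.gcd a p = 1 :=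
    Nat.coprime_pow_right_iff k.succ_pos a p
  have hper : Function.Periodic (fun a => Nat.gcd a p = 1 ∧ Nat.gcd (a + 2) p = 1) p := by
    intro a
    simp [add_right_comm a p 2]
  rw [phi2_eq_card_range, phi2_eq_card_range]
  simp only [hc]
  rw [← Nat.count_eq_card_filter_range, ← Nat.count_eq_card_filter_range, pow_succ',
    count_mul_of_periodic _ hper]

theorem sum_phi2_divisors_prime_pow {p : ℕ} (hp : p.Prime) (k : ℕ) :
    ((∑ d ∈ (p ^ k).divisors, phi2 d : ℕ) : ℚ) =
      1 + phi2 p * (((p : ℚ) ^ k - 1) / ((p : ℚ) - 1)) := by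
  have hp1 : (p : ℚ) ≠ 1 := by exact_mod_cast hp.one_lt.ne'
  rw [Nat.sum_divisors_prime_pow hp, Finset.sum_range_succ', ← geom_sum_eq hp1]
  simp only [phi2_pow_succ, pow_zero, phi2_one]
  push_cast
  rw [← Finset.sum_mul]
  ring

theorem sum_phi2_divisors_eq_prod {n : ℕ} (hn : n ≠ 0) :
    ∑ d ∈ n.divisors, phi2 d =
      ∏ p ∈ n.primeFactors, ∑ d ∈ (p ^ n.factorization p).divisors, phi2 d := by
  let f : ArithmeticFunction ℕ := ⟨phi2, rfl⟩
  have hf : f.IsMultiplicative := ⟨phi2_one, phi2_mul⟩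
  have h := (hf.mul ArithmeticFunction.isMultiplicative_zeta).multiplicative_factorization _ hn
  simp only [ArithmeticFunction.mul_zeta_apply] at h
  exact h

theorem prod_primeFactors_eq_two_pow_mul (n : ℕ) (g : ℕ → ℚ)
    (hg : g 2 = 2 ^ n.factorization 2) :
    ∏ p ∈ n.primeFactors, g p =
      2 ^ n.factorization 2 * ∏ p ∈ n.primeFactors.filter (fun p => p ≠ 2), g p := by
  rw [Finset.filter_ne']
  by_cases h : 2 ∈ n.primeFactors
  · rw [← hg, Finset.mul_prod_erase _ _ h]
  · rw [Finset.erase_eq_of_notMem h, Finsupp.notMem_support_iff.1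
      (by rwa [Nat.support_factorization]), pow_zero, one_mul]


/-- for `n = ∏_p p^{a_p}` we have
`∑_{d ∣ n} φ₂(d) = 2^{a_2} ∏_{p ∣ n, p odd} (p^{a_p}(p-2)+1)/(p-1)`, equivalently
`∑_{d ∣ n} φ₂(d) = n ∏_{p ∣ n, p odd} (φ₂(p) + p^{-a_p})/φ(p)`. -/
theorem phi2_divisor_sum (n : ℕ) (hn : 0 < n) :
    ((∑ d ∈ n.divisors, phi2 d : ℕ) : ℚ) =
        2 ^ (n.factorization 2) *
          ∏ p ∈ n.primeFactors.filter (fun p => p ≠ 2),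
            ((p : ℚ) ^ (n.factorization p) * ((p : ℚ) - 2) + 1) / ((p : ℚ) - 1) ∧
    ((∑ d ∈ n.divisors, phi2 d : ℕ) : ℚ) =
        n * ∏ p ∈ n.primeFactors.filter (fun p => p ≠ 2),
            ((phi2 p : ℚ) + (p : ℚ) ^ (-(n.factorization p : ℤ))) / (Nat.totient p : ℚ) := by
  have hfirst : ((∑ d ∈ n.divisors, phi2 d : ℕ) : ℚ) =
      2 ^ (n.factorization 2) *
        ∏ p ∈ n.primeFactors.filter (fun p => p ≠ 2),
          ((p : ℚ) ^ (n.factorization p) * ((p : ℚ) - 2) + 1) / ((p : ℚ) - 1) := by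
    rw [sum_phi2_divisors_eq_prod hn.ne', Nat.cast_prod, prod_primeFactors_eq_two_pow_mul]
    · congr 1
      refine Finset.prod_congr rfl fun p hp => ?_
      obtain ⟨hp, h2⟩ := Finset.mem_filter.1 hp
      have hp := Nat.prime_of_mem_primeFactors hp
      have hp1 : (p : ℚ) - 1 ≠ 0 := sub_ne_zero.2 (by exact_mod_cast hp.one_lt.ne')
      rw [sum_phi2_divisors_prime_pow hp, phi2_odd_prime hp h2, Nat.cast_sub hp.two_le]
      field_simp
      push_cast
      ring
    · rw [sum_phi2_divisors_prime_pow Nat.prime_two, phi2_two]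
      norm_num
  refine ⟨hfirst, hfirst.trans ?_⟩
  have hprod : (n : ℚ) = ∏ p ∈ n.primeFactors, (p : ℚ) ^ n.factorization p := by
    conv_lhs => rw [← Nat.prod_factorization_pow_eq_self hn.ne']
    simp [Finsupp.prod]
  rw [prod_primeFactors_eq_two_pow_mul n (fun p => (p : ℚ) ^ n.factorization p) (by simp)] at hprod
  conv_rhs => rw [hprod]
  rw [mul_assoc, ← Finset.prod_mul_distrib]
  congr 1
  refine Finset.prod_congr rfl fun p hp => ?_
  obtain ⟨hp, h2⟩ := Finset.mem_filter.1 hp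
  have hp := Nat.prime_of_mem_primeFactors hp
  have hp0 : (p : ℚ) ≠ 0 := by exact_mod_cast hp.ne_zero
  rw [phi2_odd_prime hp h2, Nat.totient_prime hp, Nat.cast_sub hp.two_le,
    Nat.cast_sub hp.one_le, zpow_neg, zpow_natCast, mul_div_assoc', mul_add,
    mul_inv_cancel₀ (pow_ne_zero _ hp0)]
  push_cast
  rfl
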